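/- Let k be a field, n ≥ 1, B a nonempty collection of subsets of [n], u : [n] → ℝ, and B_u the set of minimizers in B of λ ↦ Σ_{k∈λ} u(k). For all subsets μ, ν ⊆ [n] with |μ Δ ν| ≥ 4, either P_{B_u}(μ,ν) = 0 or P_{B_u}(μ,ν) = P_B(μ,ν) as polynomials in k[q]. -/

import Mathlib

open Finset MvPolynomial
open scoped symmDiff Classical

/-- The exponent `ℓ(i; μ, ν) = #{ j ∈ ν : i < j } + #{ j ∈ μ : i > j }` governing the sign
`(−1)^{sgn(i;μ,ν)}`. -/
def sgnExp {n : ℕ} (i : Fin n) (μ ν : Finset (Fin n)) : ℕ :=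
  (ν.filter fun j => i < j).card + (μ.filter fun j => j < i).card

/-- The quadric `P_B(μ,ν)` associated to a collection `B` of subsets of `[n]`:  the sum runs
only over those exchanges whose two resulting index sets both lie in `B`. -/
noncomputable def PB (k : Type*) [Field k] {n : ℕ} (B : Set (Finset (Fin n)))
    (μ ν : Finset (Fin n)) : MvPolynomial (Finset (Fin n)) k :=
  (∑ i ∈ (ν \ μ).filter (fun i => insert i μ ∈ B ∧ ν.erase i ∈ B),
      (-1 : MvPolynomial (Finset (Fin n)) k) ^ sgnExp i μ ν *
        X (insert i μ) * X (ν.erase i)) +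
  ∑ j ∈ (μ \ ν).filter (fun j => μ.erase j ∈ B ∧ insert j ν ∈ B),
      (-1 : MvPolynomial (Finset (Fin n)) k) ^ sgnExp j ν μ *
        X (μ.erase j) * X (insert j ν)

/-- `B_u`: the members of `B` minimizing the linear functional `λ ↦ Σ_{k∈λ} u(k)`. -/
def minimizers {n : ℕ} (B : Set (Finset (Fin n))) (u : Fin n → ℝ) : Set (Finset (Fin n)) :=
  {l ∈ B | ∀ l' ∈ B, ∑ k ∈ l, u k ≤ ∑ k ∈ l', u k}

theorem mem_minimizers_of_sum_add_sum_eq {n : ℕ} {B : Set (Finset (Fin n))} {u : Fin n → ℝ}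
    {a b c d : Finset (Fin n)} (ha : a ∈ minimizers B u) (hb : b ∈ minimizers B u)
    (hc : c ∈ B) (hd : d ∈ B)
    (h : ∑ k ∈ a, u k + ∑ k ∈ b, u k = ∑ k ∈ c, u k + ∑ k ∈ d, u k) :
    c ∈ minimizers B u ∧ d ∈ minimizers B u := by
  have hac := ha.2 c hc
  have hbd := hb.2 d hd
  refine ⟨⟨hc, fun l hl => ?_⟩, ⟨hd, fun l hl => ?_⟩⟩
  · linarith [ha.2 l hl]
  · linarith [hb.2 l hl]

theorem sum_insert_add_sum_erase {n : ℕ} (u : Fin n → ℝ) {μ ν : Finset (Fin n)} {i : Fin n}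
    (hi : i ∈ ν \ μ) :
    ∑ k ∈ insert i μ, u k + ∑ k ∈ ν.erase i, u k = ∑ k ∈ μ, u k + ∑ k ∈ ν, u k := by
  obtain ⟨hν, hμ⟩ := mem_sdiff.1 hi
  rw [sum_insert hμ, ← add_sum_erase ν u hν]
  ring

theorem PB_minimizers_eq_zero_or_eq (k : Type*) [Field k] {n : ℕ} (hn : 1 ≤ n)
    (B : Set (Finset (Fin n))) (hB : B.Nonempty) (u : Fin n → ℝ)
    (μ ν : Finset (Fin n)) (hμν : 4 ≤ (μ ∆ ν).card) :
    PB k (minimizers B u) μ ν = 0 ∨ PB k (minimizers B u) μ ν = PB k B μ ν := by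
  have hswap : ∀ j ∈ μ \ ν, ∑ k ∈ μ.erase j, u k + ∑ k ∈ insert j ν, u k =
      ∑ k ∈ μ, u k + ∑ k ∈ ν, u k := fun j hj => by
    linarith [sum_insert_add_sum_erase u hj]
  by_cases h : ∃ a ∈ minimizers B u, ∃ b ∈ minimizers B u,
      ∑ k ∈ a, u k + ∑ k ∈ b, u k = ∑ k ∈ μ, u k + ∑ k ∈ ν, u k
  · right
    obtain ⟨a, ha, b, hb, hab⟩ := h
    unfold PB
    congr 1
    · refine sum_congr (filter_congr fun i hi => ⟨fun h => ⟨h.1.1, h.2.1⟩, fun h => ?_⟩)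
        fun _ _ => rfl
      exact mem_minimizers_of_sum_add_sum_eq ha hb h.1 h.2
        (hab.trans (sum_insert_add_sum_erase u hi).symm)
    · refine sum_congr (filter_congr fun j hj => ⟨fun h => ⟨h.1.1, h.2.1⟩, fun h => ?_⟩)
        fun _ _ => rfl
      exact mem_minimizers_of_sum_add_sum_eq ha hb h.1 h.2 (hab.trans (hswap j hj).symm)
  · left
    unfold PB
    rw [filter_false_of_mem fun i hi hm =>
        h ⟨_, hm.1, _, hm.2, sum_insert_add_sum_erase u hi⟩,
      filter_false_of_mem fun j hj hm => h ⟨_, hm.1, _, hm.2, hswap j hj⟩]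
    simp
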